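/- Gap-ball bound in the dual for the weighted L2-loss L1-regularized SVM: let X̌ ∈ ℝ^{n×d}, w ∈ ℝ^n with wᵢ > 0 for all i, λ > 0, and let C ⊆ ℝ^n be the feasible set of all α with αᵢ ≥ 0, |Σᵢ wᵢ X̌_{ij} αᵢ| ≤ 1 for all j ∈ [d−1], and Σᵢ wᵢ X̌_{id} αᵢ = 0. Let α* be a maximizer of D_w(α) = −λ Σᵢ wᵢ (λαᵢ² − 4αᵢ)/4 over C. Then for every α̂ ∈ C and every β̂ ∈ ℝ^d, ‖α̂ − α*‖₂ ≤ √( (4/(λ² · minᵢ wᵢ)) (P_w(β̂) − D_w(α̂)) ), where P_w(β̂) = Σᵢ wᵢ (max(0, 1 − X̌_{i:}β̂))² + λ Σ_{j=1}^{d−1} |β̂_j|. -/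

import Mathlib

/-- Primal objective of the weighted L2-loss L1-regularized SVM on `ℝ^{d+1}`
(last coordinate = unpenalized intercept). -/
noncomputable def svmL2L1Primal {n d : ℕ} (X : Matrix (Fin (n + 1)) (Fin (d + 1)) ℝ)
    (w : Fin (n + 1) → ℝ) (lam : ℝ) (β : Fin (d + 1) → ℝ) : ℝ :=
  ∑ i, w i * (max 0 (1 - ∑ j, X i j * β j)) ^ 2 + lam * ∑ j : Fin d, |β j.castSucc|

/-- Dual objective of the weighted L2-loss L1-regularized SVM:
`D_w(α) = −λ Σᵢ wᵢ (λαᵢ² − 4αᵢ)/4`. -/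
noncomputable def svmL2L1Dual {n : ℕ} (w : Fin (n + 1) → ℝ) (lam : ℝ)
    (α : EuclideanSpace ℝ (Fin (n + 1))) : ℝ :=
  -lam * ∑ i, w i * (lam * (α i) ^ 2 - 4 * α i) / 4

theorem svmL2L1Dual_le_primal {n d : ℕ} (X : Matrix (Fin (n + 1)) (Fin (d + 1)) ℝ)
    (w : Fin (n + 1) → ℝ) (hw : ∀ i, 0 < w i) (lam : ℝ) (hlam : 0 < lam)
    (α : EuclideanSpace ℝ (Fin (n + 1))) (hα : ∀ i, 0 ≤ α i)
    (hbox : ∀ j : Fin d, |∑ i, w i * X i j.castSucc * α i| ≤ 1)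
    (hlast : ∑ i, w i * X i (Fin.last d) * α i = 0) (β : Fin (d + 1) → ℝ) :
    svmL2L1Dual w lam α ≤ svmL2L1Primal X w lam β := by
  have hloss : ∀ i, w i * (lam * α i * (1 - ∑ j, X i j * β j) - lam ^ 2 * α i ^ 2 / 4) ≤
      w i * (max 0 (1 - ∑ j, X i j * β j)) ^ 2 := by
    intro i
    refine mul_le_mul_of_nonneg_left ?_ (hw i).le
    have hle := mul_le_mul_of_nonneg_left (le_max_right 0 (1 - ∑ j, X i j * β j))
      (mul_nonneg hlam.le (hα i))
    nlinarith [sq_nonneg (max 0 (1 - ∑ j, X i j * β j) - lam * α i / 2)]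
  have hswap : ∑ i, w i * α i * ∑ j, X i j * β j =
      ∑ j, (∑ i, w i * X i j * α i) * β j := by
    simp_rw [Finset.mul_sum, Finset.sum_mul]
    rw [Finset.sum_comm]
    refine Finset.sum_congr rfl fun j _ => Finset.sum_congr rfl fun i _ => ?_
    ring
  have hpen : ∑ i, w i * α i * ∑ j, X i j * β j ≤ ∑ j : Fin d, |β j.castSucc| := by
    rw [hswap, Fin.sum_univ_castSucc, hlast, zero_mul, add_zero]
    refine Finset.sum_le_sum fun j _ => (le_abs_self _).trans ?_
    rw [abs_mul]
    exact mul_le_of_le_one_left (abs_nonneg _) (hbox j)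
  have hsum := Finset.sum_le_sum fun i (_ : i ∈ Finset.univ) => hloss i
  have hdual : ∑ i, w i * (lam * α i * (1 - ∑ j, X i j * β j) - lam ^ 2 * α i ^ 2 / 4) =
      svmL2L1Dual w lam α - lam * ∑ i, w i * α i * ∑ j, X i j * β j := by
    unfold svmL2L1Dual
    rw [Finset.mul_sum, Finset.mul_sum, ← Finset.sum_sub_distrib]
    refine Finset.sum_congr rfl fun i _ => ?_
    ring
  have hpen' := mul_le_mul_of_nonneg_left hpen hlam.le
  unfold svmL2L1Primal
  linarith

theorem svmL2L1Dual_segment {n : ℕ} (w : Fin (n + 1) → ℝ) (lam t : ℝ)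
    (a b : EuclideanSpace ℝ (Fin (n + 1))) :
    svmL2L1Dual w lam ((1 - t) • a + t • b) =
      (1 - t) * svmL2L1Dual w lam a + t * svmL2L1Dual w lam b +
        t * (1 - t) * (lam ^ 2 / 4 * ∑ i, w i * (b i - a i) ^ 2) := by
  unfold svmL2L1Dual
  simp only [Finset.mul_sum, ← Finset.sum_add_distrib, PiLp.add_apply, PiLp.smul_apply,
    smul_eq_mul]
  refine Finset.sum_congr rfl fun i _ => ?_
  ring

theorem svmL2L1Dual_quadratic_growth {n : ℕ} (w : Fin (n + 1) → ℝ) (lam : ℝ)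
    {C : Set (EuclideanSpace ℝ (Fin (n + 1)))} (hC : Convex ℝ C)
    {a b : EuclideanSpace ℝ (Fin (n + 1))} (ha : a ∈ C) (hb : b ∈ C)
    (hmax : ∀ α ∈ C, svmL2L1Dual w lam α ≤ svmL2L1Dual w lam a) :
    lam ^ 2 / 4 * ∑ i, w i * (b i - a i) ^ 2 ≤
      svmL2L1Dual w lam a - svmL2L1Dual w lam b := by
  set Q := lam ^ 2 / 4 * ∑ i, w i * (b i - a i) ^ 2 with hQ
  have hseg : ∀ t : ℝ, 0 < t → t < 1 →
      (1 - t) * Q ≤ svmL2L1Dual w lam a - svmL2L1Dual w lam b := by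
    intro t h0 h1
    have hm := hmax _ (hC ha hb (sub_nonneg.2 h1.le) h0.le (by ring))
    rw [svmL2L1Dual_segment, ← hQ] at hm
    refine le_of_mul_le_mul_left ?_ h0
    linarith
  have hlim : Filter.Tendsto (fun t : ℝ => (1 - t) * Q) (nhdsWithin 0 (Set.Ioi 0)) (nhds Q) := by
    have hc : Continuous fun t : ℝ => (1 - t) * Q := by fun_prop
    simpa using (hc.tendsto 0).mono_left nhdsWithin_le_nhds
  refine le_of_tendsto hlim ?_
  filter_upwards [Ioo_mem_nhdsGT (zero_lt_one (α := ℝ))] with t ht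
  exact hseg t ht.1 ht.2

theorem convex_svmL2L1_feasible {n d : ℕ} (X : Matrix (Fin (n + 1)) (Fin (d + 1)) ℝ)
    (w : Fin (n + 1) → ℝ) :
    Convex ℝ {α : EuclideanSpace ℝ (Fin (n + 1)) |
      (∀ i, 0 ≤ α i) ∧
      (∀ j : Fin d, |∑ i, w i * X i j.castSucc * α i| ≤ 1) ∧
      ∑ i, w i * X i (Fin.last d) * α i = 0} := by
  rintro a ⟨ha, hab, hal⟩ b ⟨hb, hbb, hbl⟩ s t hs ht hst
  have hlin : ∀ j, ∑ i, w i * X i j * (s • a + t • b) i =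
      s * ∑ i, w i * X i j * a i + t * ∑ i, w i * X i j * b i := by
    intro j
    simp only [Finset.mul_sum, ← Finset.sum_add_distrib, PiLp.add_apply, PiLp.smul_apply,
      smul_eq_mul]
    refine Finset.sum_congr rfl fun i _ => ?_
    ring
  refine ⟨fun i => ?_, fun j => ?_, ?_⟩
  · simp only [PiLp.add_apply, PiLp.smul_apply, smul_eq_mul]
    have := ha i
    have := hb i
    positivity
  · rw [hlin, abs_le]
    obtain ⟨h1, h2⟩ := abs_le.1 (hab j)
    obtain ⟨h3, h4⟩ := abs_le.1 (hbb j)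
    constructor <;> nlinarith
  · rw [hlin, hal, hbl]
    ring

/-- Gap-ball bound in the dual for the weighted L2-loss
L1-regularized SVM: let `C` be the dual feasible set, `αstar` a maximizer of `D_w`
over `C`. Then for every `αhat ∈ C` and every `βhat`,
`‖αhat − αstar‖₂ ≤ √((4/(λ² · minᵢ wᵢ)) (P_w(βhat) − D_w(αhat)))`. -/
theorem stmt11 {n d : ℕ} (X : Matrix (Fin (n + 1)) (Fin (d + 1)) ℝ)
    (w : Fin (n + 1) → ℝ) (hw : ∀ i, 0 < w i) (lam : ℝ) (hlam : 0 < lam)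
    (C : Set (EuclideanSpace ℝ (Fin (n + 1))))
    (hC : C = {α : EuclideanSpace ℝ (Fin (n + 1)) |
      (∀ i, 0 ≤ α i) ∧
      (∀ j : Fin d, |∑ i, w i * X i j.castSucc * α i| ≤ 1) ∧
      ∑ i, w i * X i (Fin.last d) * α i = 0})
    (αstar : EuclideanSpace ℝ (Fin (n + 1))) (hαstarC : αstar ∈ C)
    (hmax : ∀ α ∈ C, svmL2L1Dual w lam α ≤ svmL2L1Dual w lam αstar)
    (αhat : EuclideanSpace ℝ (Fin (n + 1))) (hαhatC : αhat ∈ C)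
    (βhat : Fin (d + 1) → ℝ) :
    ‖αhat - αstar‖ ≤
      Real.sqrt ((4 / (lam ^ 2 * Finset.univ.inf' ⟨0, Finset.mem_univ 0⟩ w)) *
        (svmL2L1Primal X w lam βhat - svmL2L1Dual w lam αhat)) := by
  subst hC
  obtain ⟨hpos, hbox, hlast⟩ := hαhatC
  obtain ⟨hpos', hbox', hlast'⟩ := hαstarC
  have hgrowth := svmL2L1Dual_quadratic_growth w lam (convex_svmL2L1_feasible X w)
    ⟨hpos', hbox', hlast'⟩ ⟨hpos, hbox, hlast⟩ hmax
  have hweak := svmL2L1Dual_le_primal X w hw lam hlam αstar hpos' hbox' hlast' βhat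
  set m := Finset.univ.inf' ⟨0, Finset.mem_univ 0⟩ w with hm
  have hm0 : 0 < m := (Finset.lt_inf'_iff _).2 fun i _ => hw i
  have hmle : m * ‖αhat - αstar‖ ^ 2 ≤ ∑ i, w i * (αhat i - αstar i) ^ 2 := by
    rw [EuclideanSpace.real_norm_sq_eq, Finset.mul_sum]
    refine Finset.sum_le_sum fun i hi => ?_
    exact mul_le_mul_of_nonneg_right (Finset.inf'_le w hi) (sq_nonneg _)
  refine Real.le_sqrt_of_sq_le ?_
  rw [div_mul_eq_mul_div, le_div_iff₀ (by positivity)]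
  have := mul_le_mul_of_nonneg_left hmle (sq_nonneg lam)
  linarith
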